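/- arXiv:2010.10023 — 3 statements merged into one kernel-verified Lean document; each statement's English description precedes it below -/
import Mathlib

section
/- Let p be a prime, n and k positive integers, and F : GF(p^n) → GF(p^n) the power function F(x) = x^d with d = p^k + 1. For every c ∈ GF(p^{gcd(k,n)}) (viewed inside GF(p^n)) with c ≠ 1, the c-differential uniformity of F equals gcd(p^k + 1, p^n − 1). -/
open scoped Classical

/-- The number of solutions `x` of `F(x+a) - c·F(x) = b`, denoted `_cΔ_F(a,b)`. -/
noncomputable def deltaCount {F : Type*} [Field F] [Finite F]
    (f : F → F) (c a b : F) : ℕ :=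
  Nat.card {x : F // f (x + a) - c * f x = b}

/-- The `c`-differential uniformity of `F`: the maximum of `_cΔ_F(a,b)` over all
`a, b`, where `a ≠ 0` is required when `c = 1`. -/
noncomputable def cDiffUniformity {F : Type*} [Field F] [Finite F]
    (f : F → F) (c : F) : ℕ :=
  letI : Fintype F := Fintype.ofFinite F
  ((Finset.univ ×ˢ Finset.univ).filter fun ab : F × F => c ≠ 1 ∨ ab.1 ≠ 0).sup
    fun ab => deltaCount f c ab.1 ab.2

theorem card_pow_eq_one_eq_gcd {K : Type*} [Field K] [Finite K] {d : ℕ} (hd : d ≠ 0) :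
    Nat.card {x : K // x ^ d = 1} = Nat.gcd d (Nat.card K - 1) := by
  rw [← Nat.card_units, Nat.gcd_comm, ← IsCyclic.card_powMonoidHom_ker]
  symm
  refine Nat.card_congr (Equiv.ofBijective
    (fun u : (powMonoidHom d : Kˣ →* Kˣ).ker => (⟨(u : Kˣ), ?_⟩ : {x : K // x ^ d = 1})) ⟨?_, ?_⟩)
  · have h : (u : Kˣ) ^ d = 1 := u.2
    simpa using congrArg Units.val h
  · intro u v h
    exact Subtype.ext (Units.ext (congrArg Subtype.val h))
  · rintro ⟨x, hx⟩
    refine ⟨⟨Units.ofPowEqOne x d hx hd, ?_⟩, rfl⟩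
    exact Units.pow_ofPowEqOne hx hd

theorem card_pow_eq_le {K : Type*} [Field K] [Finite K] {d : ℕ} (hd : d ≠ 0) (t : K) :
    Nat.card {x : K // x ^ d = t} ≤ Nat.card {x : K // x ^ d = 1} := by
  rcases isEmpty_or_nonempty {x : K // x ^ d = t} with h | ⟨⟨y, hy⟩⟩
  · simp
  rcases eq_or_ne t 0 with rfl | ht
  · have : Subsingleton {x : K // x ^ d = 0} :=
      ⟨fun u v => Subtype.ext ((eq_zero_of_pow_eq_zero u.2).trans
        (eq_zero_of_pow_eq_zero v.2).symm)⟩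
    have : Nonempty {x : K // x ^ d = 1} := ⟨⟨1, one_pow d⟩⟩
    exact Finite.card_le_one_iff_subsingleton.2 ‹_› |>.trans Nat.card_pos
  · have hy0 : y ≠ 0 := by
      rintro rfl
      exact ht (by rw [← hy, zero_pow hd])
    refine Nat.card_le_card_of_injective
      (fun x => (⟨x / y, by rw [div_pow, x.2, hy, div_self ht]⟩ : {x : K // x ^ d = 1})) ?_
    intro u v h
    exact Subtype.ext ((div_left_inj' hy0).1 (congrArg Subtype.val h))

theorem pow_pow_eq_self_of_dvd {M : Type*} [Monoid M] {c : M} {p m k : ℕ}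
    (h : c ^ p ^ m = c) (hmk : m ∣ k) : c ^ p ^ k = c := by
  obtain ⟨j, rfl⟩ := hmk
  rw [pow_mul]
  exact (congrFun (pow_iterate (p ^ m) j) c).symm.trans (Function.iterate_fixed h j)

theorem deltaCount_pow_add_one {K : Type*} [Field K] [Finite K] {p k : ℕ} [Fact p.Prime]
    [CharP K p] {c : K} (hc : c ≠ 1) (hck : c ^ p ^ k = c) (a b : K) :
    ∃ t : K, deltaCount (fun x : K => x ^ (p ^ k + 1)) c a b =
      Nat.card {x : K // x ^ (p ^ k + 1) = t} := by
  have hu : 1 - c ≠ 0 := sub_ne_zero.2 hc.symm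
  have huk : (1 - c) ^ p ^ k = 1 - c := by rw [sub_pow_char_pow, one_pow, hck]
  refine ⟨(b - a ^ (p ^ k + 1) + a ^ (p ^ k + 1) / (1 - c)) / (1 - c),
    Nat.card_congr ((Equiv.addRight (a / (1 - c))).subtypeEquiv fun x => ?_)⟩
  simp only [Equiv.coe_addRight, pow_succ, add_pow_char_pow, div_pow, huk]
  generalize x ^ p ^ k = X
  generalize a ^ p ^ k = A
  rw [eq_div_iff hu, ← sub_eq_zero, ← sub_eq_zero (b := b - A * a + A * a / (1 - c))]
  have : (X + A) * (x + a) - c * (X * x) - b =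
      (X + A / (1 - c)) * (x + a / (1 - c)) * (1 - c) -
        (b - A * a + A * a / (1 - c)) := by
    field_simp
    ring
  rw [this]

theorem stmt_3 (p n k : ℕ) [Fact p.Prime] (hn : 0 < n) (hk : 0 < k)
    (c : GaloisField p n) (hc : c ≠ 1)
    (hsub : c ^ p ^ Nat.gcd k n = c) :
    cDiffUniformity (fun x : GaloisField p n => x ^ (p ^ k + 1)) c =
      Nat.gcd (p ^ k + 1) (p ^ n - 1) := by
  have hd : p ^ k + 1 ≠ 0 := Nat.succ_ne_zero _
  have hck := pow_pow_eq_self_of_dvd hsub (Nat.gcd_dvd_left k n)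
  rw [← GaloisField.card p n hn.ne', ← card_pow_eq_one_eq_gcd hd]
  unfold cDiffUniformity
  apply le_antisymm
  · refine Finset.sup_le fun ab _ => ?_
    obtain ⟨t, ht⟩ := deltaCount_pow_add_one hc hck ab.1 ab.2
    exact ht.trans_le (card_pow_eq_le hd t)
  · have hu : 1 - c ≠ 0 := sub_ne_zero.2 hc.symm
    let : Fintype (GaloisField p n) := Fintype.ofFinite _
    refine le_trans (le_of_eq ?_) (Finset.le_sup (b := (0, 1 - c)) (by simp [hc]))
    refine Nat.card_congr (Equiv.subtypeEquivRight fun x => ?_)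
    rw [add_zero, ← one_sub_mul, mul_eq_left₀ hu]
end

section
/- Let p be an odd prime, n and k positive integers, and F : GF(p^n) → GF(p^n) the power function F(x) = x^{p^k+1}. Let c ∈ GF(p^{gcd(k,n)}) with c ≠ 1. If n/gcd(n,k) is odd, then F is APcN (its c-differential uniformity equals 2); if n/gcd(n,k) is even, then the c-differential uniformity of F equals p^{gcd(k,n)} + 1. -/
open scoped Classical

theorem gcd_pow_sub_one_pow_add_one_dvd (P m k : ℕ) (hP : 0 < P) :
    Nat.gcd (P ^ m - 1) (P ^ k + 1) ∣ P ^ Nat.gcd m (2 * k) - 1 := by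
  rw [← Nat.pow_sub_one_gcd_pow_sub_one]
  refine Nat.gcd_dvd_gcd_of_dvd_right _ ⟨P ^ k - 1, ?_⟩
  obtain ⟨t, ht⟩ := Nat.exists_eq_add_of_le (Nat.one_le_pow k P hP)
  rw [mul_comm 2 k, pow_mul, ht, add_tsub_cancel_left]
  exact Nat.sub_eq_of_eq_add (by ring)

theorem gcd_pow_sub_one_pow_add_one_of_odd {P m k : ℕ} (hP : Odd P) (hm : Odd m)
    (hmk : Nat.Coprime m k) : Nat.gcd (P ^ m - 1) (P ^ k + 1) = 2 := by
  have hg := gcd_pow_sub_one_pow_add_one_dvd P m k hP.pos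
  rw [(Nat.Coprime.mul_right hm.coprime_two_right hmk : Nat.gcd m (2 * k) = 1), pow_one] at hg
  apply Nat.dvd_antisymm
  · have hdvd : P - 1 ∣ P ^ k - 1 := by simpa using Nat.sub_dvd_pow_sub_pow P 1 k
    have hsum : P ^ k + 1 = P ^ k - 1 + 2 := by
      have := Nat.one_le_pow k P hP.pos
      omega
    have hright := Nat.gcd_dvd_right (P ^ m - 1) (P ^ k + 1)
    exact (Nat.dvd_add_right (hg.trans hdvd)).1 (hsum ▸ hright)
  · exact Nat.dvd_gcd (Nat.Odd.sub_odd hP.pow odd_one).two_dvd (hP.pow.add_odd odd_one).two_dvd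

theorem gcd_pow_sub_one_pow_add_one_of_even {P m k : ℕ} (hP : 0 < P) (hm : Even m)
    (hmk : Nat.Coprime m k) : Nat.gcd (P ^ m - 1) (P ^ k + 1) = P + 1 := by
  have hk : Odd k := by
    rw [← Nat.not_even_iff_odd]
    intro hk
    have := Nat.dvd_gcd hm.two_dvd hk.two_dvd
    rw [hmk.gcd_eq_one] at this
    omega
  have hg := gcd_pow_sub_one_pow_add_one_dvd P m k hP
  rw [hmk.symm.gcd_mul_right_cancel_right 2, Nat.gcd_eq_right hm.two_dvd] at hg
  have hsq : P + 1 ∣ P ^ 2 - 1 := ⟨P - 1, by simpa using Nat.sq_sub_sq P 1⟩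
  apply Nat.dvd_antisymm
  · obtain ⟨j, rfl⟩ := hk
    have hdvd : P ^ 2 - 1 ∣ (P ^ 2) ^ j - 1 := by simpa using Nat.sub_dvd_pow_sub_pow (P ^ 2) 1 j
    have hsum : P ^ (2 * j + 1) + 1 = P * ((P ^ 2) ^ j - 1) + (P + 1) := by
      obtain ⟨t, ht⟩ := Nat.exists_eq_add_of_le (Nat.one_le_pow j (P ^ 2) (by positivity))
      rw [pow_succ, pow_mul, ht, add_tsub_cancel_left]
      ring
    have hright := Nat.gcd_dvd_right (P ^ m - 1) (P ^ (2 * j + 1) + 1)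
    exact (Nat.dvd_add_right ((hg.trans hdvd).mul_left P)).1 (hsum ▸ hright)
  · refine Nat.dvd_gcd ?_ (by simpa using hk.nat_add_dvd_pow_add_pow P 1)
    obtain ⟨j, rfl⟩ := hm.two_dvd
    rw [pow_mul]
    exact hsq.trans (by simpa using Nat.sub_dvd_pow_sub_pow (P ^ 2) 1 j)

section PowerFibers

variable {F : Type*} [Field F] [Finite F]

theorem card_pow_eq_one_eq_gcd_s4 {m : ℕ} (hm : m ≠ 0) :
    Nat.card {x : F // x ^ m = 1} = Nat.gcd (Nat.card F - 1) m := by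
  rw [← Nat.card_units F, ← IsCyclic.card_powMonoidHom_ker]
  symm
  refine Nat.card_eq_of_bijective
    (fun u : (powMonoidHom m : Fˣ →* Fˣ).ker =>
      (⟨(u : Fˣ), by
        simpa only [Units.ext_iff, powMonoidHom_apply, Units.val_pow_eq_pow_val, Units.val_one] using
          MonoidHom.mem_ker.1 u.2⟩ : {x : F // x ^ m = 1})) ⟨?_, ?_⟩
  · intro u v huv
    exact Subtype.ext (Units.ext (congrArg Subtype.val huv))
  · rintro ⟨x, hx⟩
    have hx0 : x ≠ 0 := by
      rintro rfl
      simp [hm] at hx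
    exact ⟨⟨Units.mk0 x hx0, by simpa [Units.ext_iff] using hx⟩, rfl⟩

theorem card_pow_eq_le_card_pow_eq_one {m : ℕ} (hm : m ≠ 0) (b : F) :
    Nat.card {x : F // x ^ m = b} ≤ Nat.card {x : F // x ^ m = 1} := by
  rcases isEmpty_or_nonempty {x : F // x ^ m = b} with h | ⟨⟨y, hy⟩⟩
  · simp
  by_cases hb : b = 0
  · have : Subsingleton {x : F // x ^ m = b} :=
      ⟨fun u v => Subtype.ext (by
        rw [pow_eq_zero_iff hm |>.1 (u.2.trans hb), pow_eq_zero_iff hm |>.1 (v.2.trans hb)])⟩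
    have : Nonempty {x : F // x ^ m = 1} := ⟨⟨1, one_pow m⟩⟩
    exact (Finite.card_le_one_iff_subsingleton.2 inferInstance).trans Nat.card_pos
  · have hy0 : y ≠ 0 := by
      rintro rfl
      exact hb (by rw [← hy, zero_pow hm])
    refine Nat.card_le_card_of_injective
      (fun u : {x : F // x ^ m = b} =>
        (⟨u / y, by rw [div_pow, u.2, hy, div_self hb]⟩ : {x : F // x ^ m = 1})) ?_
    intro u v huv
    exact Subtype.ext ((div_left_inj' hy0).1 (congrArg Subtype.val huv))

theorem deltaCount_pow_expChar_add_one {p : ℕ} [ExpChar F p] (k : ℕ) {c : F} (hc : c ≠ 1)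
    (hck : c ^ p ^ k = c) (a b : F) :
    deltaCount (fun x : F => x ^ (p ^ k + 1)) c a b =
      Nat.card {y : F // y ^ (p ^ k + 1) =
        (b - a ^ (p ^ k + 1)) / (1 - c) + (a / (1 - c)) ^ (p ^ k + 1)} := by
  have hu : 1 - c ≠ 0 := sub_ne_zero.2 hc.symm
  have huk : (1 - c) ^ p ^ k = 1 - c := by rw [sub_pow_expChar_pow, one_pow, hck]
  refine Nat.card_congr ((Equiv.addRight (a / (1 - c))).subtypeEquiv fun x => ?_)
  rw [Equiv.coe_addRight]
  simp only [pow_succ, add_pow_expChar_pow, div_pow, huk]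
  field_simp
  constructor
  · intro h
    linear_combination (1 - c) * h
  · intro h
    refine mul_left_cancel₀ hu ?_
    linear_combination h

theorem cDiffUniformity_pow_expChar_add_one {p : ℕ} [ExpChar F p] (k : ℕ) {c : F} (hc : c ≠ 1)
    (hck : c ^ p ^ k = c) :
    cDiffUniformity (fun x : F => x ^ (p ^ k + 1)) c =
      Nat.gcd (Nat.card F - 1) (p ^ k + 1) := by
  rw [← card_pow_eq_one_eq_gcd_s4 (F := F) (Nat.succ_ne_zero _)]
  have hu : 1 - c ≠ 0 := sub_ne_zero.2 hc.symm
  let _ : Fintype F := Fintype.ofFinite F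
  apply le_antisymm
  · refine Finset.sup_le fun ab _ => ?_
    rw [deltaCount_pow_expChar_add_one k hc hck]
    exact card_pow_eq_le_card_pow_eq_one (Nat.succ_ne_zero _) _
  · have hcount : deltaCount (fun x : F => x ^ (p ^ k + 1)) c 0 (1 - c) =
        Nat.card {x : F // x ^ (p ^ k + 1) = 1} := by
      rw [deltaCount_pow_expChar_add_one k hc hck]
      simp [hu]
    rw [← hcount]
    exact Finset.le_sup (f := fun ab : F × F =>
      deltaCount (fun x : F => x ^ (p ^ k + 1)) c ab.1 ab.2)
      (b := ((0 : F), 1 - c)) (by simp [hc])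

end PowerFibers

theorem stmt_4 (p n k : ℕ) [Fact p.Prime] (hodd : Odd p) (hn : 0 < n) (hk : 0 < k)
    (c : GaloisField p n) (hc : c ≠ 1)
    (hsub : c ^ p ^ Nat.gcd k n = c) :
    (Odd (n / Nat.gcd n k) →
      cDiffUniformity (fun x : GaloisField p n => x ^ (p ^ k + 1)) c = 2) ∧
    (Even (n / Nat.gcd n k) →
      cDiffUniformity (fun x : GaloisField p n => x ^ (p ^ k + 1)) c =
        p ^ Nat.gcd k n + 1) := by
  have hdpos : 0 < Nat.gcd n k := Nat.gcd_pos_of_pos_left k hn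
  have hcop : Nat.Coprime (n / Nat.gcd n k) (k / Nat.gcd n k) := Nat.coprime_div_gcd_div_gcd hdpos
  have hnd : (p ^ Nat.gcd n k) ^ (n / Nat.gcd n k) = p ^ n := by
    rw [← pow_mul, Nat.mul_div_cancel' (Nat.gcd_dvd_left n k)]
  have hkd : (p ^ Nat.gcd n k) ^ (k / Nat.gcd n k) = p ^ k := by
    rw [← pow_mul, Nat.mul_div_cancel' (Nat.gcd_dvd_right n k)]
  rw [Nat.gcd_comm k n] at hsub ⊢
  have hck : c ^ p ^ k = c := by
    rw [← hkd]
    generalize k / Nat.gcd n k = j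
    induction j with
    | zero => simp
    | succ j ih => rw [pow_succ, pow_mul, ih, hsub]
  have : ExpChar (GaloisField p n) p := expChar_of_injective_algebraMap
    (algebraMap (ZMod p) (GaloisField p n)).injective p
  rw [cDiffUniformity_pow_expChar_add_one k hc hck, GaloisField.card p n hn.ne', ← hnd, ← hkd]
  exact ⟨fun h => gcd_pow_sub_one_pow_add_one_of_odd hodd.pow h hcop,
    fun h => gcd_pow_sub_one_pow_add_one_of_even (pow_pos hodd.pos _) h hcop⟩
end

section
/- Let p > 3 be an odd prime, n a positive integer with p^n ≡ 1 (mod 4), and F : GF(p^n) → GF(p^n) the power function F(x) = x^d with d = (p^n + 3)/2. Then the (−1)-differential uniformity of F is at most 4. -/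
open scoped Classical

section PowerMap

variable {F : Type*} [Field F]

lemma pow_card_add_three_div_two_eq [Fintype F] (h4 : Fintype.card F % 4 = 1) (x : F) :
    x ^ ((Fintype.card F + 3) / 2) = if IsSquare x then x ^ 2 else -x ^ 2 := by
  have hchar : ringChar F ≠ 2 := fun h => by
    have := FiniteField.even_card_of_char_two h
    omega
  have hd : (Fintype.card F + 3) / 2 = Fintype.card F / 2 + 2 := by omega
  rw [hd, pow_add]
  rcases eq_or_ne x 0 with rfl | hx
  · simp
  · have hiff := FiniteField.isSquare_iff hchar hx
    rcases FiniteField.pow_dichotomy hchar hx with h | h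
    · rw [if_pos (hiff.2 h), h, one_mul]
    · rw [if_neg, h, neg_one_mul]
      rw [hiff, h]
      exact Ring.neg_one_ne_one_of_char_ne_two hchar

lemma FiniteField.isSquare_mul_of_not_isSquare [Fintype F] {x y : F}
    (hx : ¬IsSquare x) (hy : ¬IsSquare y) : IsSquare (x * y) := by
  have hx0 : x ≠ 0 := by rintro rfl; exact hx (.zero)
  have hy0 : y ≠ 0 := by rintro rfl; exact hy (.zero)
  rw [← quadraticChar_one_iff_isSquare (mul_ne_zero hx0 hy0), map_mul,
    (quadraticChar_neg_one_iff_not_isSquare).2 hx, (quadraticChar_neg_one_iff_not_isSquare).2 hy]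
  norm_num

lemma ncard_two_mul_add_sq_eq_le_two (h2 : (2 : F) ≠ 0) (a c : F) :
    {x : F | (2 * x + a) ^ 2 = c}.ncard ≤ 2 := by
  rcases Set.eq_empty_or_nonempty {x : F | (2 * x + a) ^ 2 = c} with h | ⟨y, hy⟩
  · simp [h]
  · refine (Set.ncard_le_ncard (t := {y, -y - a}) ?_ (Set.toFinite _)).trans ?_
    swap
    · exact (Set.ncard_insert_le _ _).trans (by simp)
    intro x hx
    have hmul : (x - y) * (x + y + a) = 0 := by
      apply mul_left_cancel₀ (mul_ne_zero h2 h2)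
      linear_combination (Set.mem_ofPred.1 hx) - (Set.mem_ofPred.1 hy)
    rcases mul_eq_zero.1 hmul with h | h
    · exact Or.inl (sub_eq_zero.1 h)
    · exact Or.inr (Set.mem_singleton_iff.2 (by linear_combination h))

lemma exists_subset_two_mul_add_sq_eq [Fintype F] (h4 : Fintype.card F % 4 = 1) (a b : F) :
    ∃ c₁ c₂ : F, {x : F | (x + a) ^ ((Fintype.card F + 3) / 2) +
        x ^ ((Fintype.card F + 3) / 2) = b} ⊆
      {x | (2 * x + a) ^ 2 = c₁} ∪ {x | (2 * x + a) ^ 2 = c₂} := by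
  have hchar : ringChar F ≠ 2 := fun h => by
    have := FiniteField.even_card_of_char_two h
    omega
  have h2 : (2 : F) ≠ 0 := Ring.two_ne_zero hchar
  set S := {x : F | (x + a) ^ ((Fintype.card F + 3) / 2) +
    x ^ ((Fintype.card F + 3) / 2) = b} with hS
  have hmem (x : F) (hx : x ∈ S) : (if IsSquare (x + a) then (x + a) ^ 2 else -(x + a) ^ 2) +
      (if IsSquare x then x ^ 2 else -x ^ 2) = b := by
    rw [← pow_card_add_three_div_two_eq h4, ← pow_card_add_three_div_two_eq h4]
    exact hx
  have hsq (x : F) (hx : x ∈ S) (hu : IsSquare (x + a)) (hv : IsSquare x) :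
      (2 * x + a) ^ 2 = 2 * b - a ^ 2 := by
    have := hmem x hx
    rw [if_pos hu, if_pos hv] at this
    linear_combination 2 * this
  have hnsq (x : F) (hx : x ∈ S) (hu : ¬IsSquare (x + a)) (hv : ¬IsSquare x) :
      (2 * x + a) ^ 2 = -2 * b - a ^ 2 := by
    have := hmem x hx
    rw [if_neg hu, if_neg hv] at this
    linear_combination -2 * this
  have hmix (x : F) (hx : x ∈ S) (huv : ¬(IsSquare (x + a) ↔ IsSquare x)) :
      a ≠ 0 ∧ a ^ 2 * (2 * x + a) ^ 2 = b ^ 2 := by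
    refine ⟨by rintro rfl; simp at huv, ?_⟩
    have := hmem x hx
    by_cases hu : IsSquare (x + a) <;> by_cases hv : IsSquare x <;> simp [hu, hv] at huv this <;>
      rw [← this] <;> ring
  have hmix' (x : F) (hx : x ∈ S) (huv : ¬(IsSquare (x + a) ↔ IsSquare x)) :
      (2 * x + a) ^ 2 = b ^ 2 / a ^ 2 := by
    obtain ⟨ha, h⟩ := hmix x hx huv
    rw [eq_div_iff (pow_ne_zero 2 ha), ← h, mul_comm]
  by_cases hA : ∃ x ∈ S, IsSquare (x + a) ∧ IsSquare x
  swap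
  · refine ⟨-2 * b - a ^ 2, b ^ 2 / a ^ 2, fun x hx => ?_⟩
    by_cases huv : IsSquare (x + a) ↔ IsSquare x
    · have hv : ¬IsSquare x := fun hv => hA ⟨x, hx, huv.2 hv, hv⟩
      exact Or.inl (hnsq x hx (huv.not.2 hv) hv)
    · exact Or.inr (hmix' x hx huv)
  by_cases hB : ∃ x ∈ S, ¬IsSquare (x + a) ∧ ¬IsSquare x
  swap
  · refine ⟨2 * b - a ^ 2, b ^ 2 / a ^ 2, fun x hx => ?_⟩
    by_cases huv : IsSquare (x + a) ↔ IsSquare x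
    · have hv : IsSquare x := by_contra fun hv => hB ⟨x, hx, huv.not.2 hv, hv⟩
      exact Or.inl (hsq x hx (huv.2 hv) hv)
    · exact Or.inr (hmix' x hx huv)
  refine ⟨2 * b - a ^ 2, -2 * b - a ^ 2, fun x hx => ?_⟩
  by_cases huv : IsSquare (x + a) ↔ IsSquare x
  · by_cases hv : IsSquare x
    · exact Or.inl (hsq x hx (huv.2 hv) hv)
    · exact Or.inr (hnsq x hx (huv.not.2 hv) hv)
  exfalso
  obtain ⟨y, hy, hyu, hyv⟩ := hA
  obtain ⟨z, hz, hzu, hzv⟩ := hB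
  obtain ⟨ha, hxb⟩ := hmix x hx huv
  have hneg1 : IsSquare (-1 : F) := FiniteField.isSquare_neg_one_iff.2 (by omega)
  obtain ⟨i, hi⟩ := id hneg1
  obtain ⟨r, hr⟩ := hyu.mul hyv
  obtain ⟨s, hs⟩ := FiniteField.isSquare_mul_of_not_isSquare hzu hzv
  have hyb := hsq y hy hyu hyv
  have hzb := hnsq z hz hzu hzv
  have hsq_mul : (x + a) * x * (2 * a) ^ 2 = (2 * i * (r * s)) ^ 2 := by
    have hy4 : 4 * (r * r) = 2 * b - 2 * a ^ 2 := by
      linear_combination hyb - 4 * hr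
    have hz4 : 4 * (s * s) = -2 * b - 2 * a ^ 2 := by
      linear_combination hzb - 4 * hs
    have hi' : i ^ 2 = -1 := by rw [hi, sq]
    have hrs : 16 * (r * s) ^ 2 = 4 * a ^ 4 - 4 * b ^ 2 := by
      linear_combination 4 * s ^ 2 * hy4 + (2 * b - 2 * a ^ 2) * hz4
    apply mul_left_cancel₀ (mul_ne_zero h2 h2)
    linear_combination 4 * hxb - 16 * (r * s) ^ 2 * hi' + hrs
  have hprod : IsSquare ((x + a) * x) :=
    ⟨2 * i * (r * s) / (2 * a), by
      rw [div_mul_div_comm, eq_div_iff (by simp [h2, ha])]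
      linear_combination hsq_mul⟩
  by_cases hx0 : (x + a) * x = 0
  · have hneg : IsSquare a ↔ IsSquare (-a) := by
      refine ⟨fun h => ?_, fun h => ?_⟩
      · simpa using hneg1.mul h
      · simpa using hneg1.mul h
    have hs0 : s ≠ 0 := by
      rintro rfl
      rcases mul_eq_zero.1 (hs.trans (mul_zero 0)) with h | h
      · exact hzu (h ▸ .zero)
      · exact hzv (h ▸ .zero)
    have hi0 : i ≠ 0 := by rintro rfl; simp at hi
    have hr0 : r = 0 := by
      rw [hx0, zero_mul] at hsq_mul
      simpa [h2, hs0, hi0] using hsq_mul.symm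
    have hsqa : IsSquare a := by
      rcases mul_eq_zero.1 (hr.trans (by rw [hr0, mul_zero])) with h | h
      · rw [hneg, ← eq_neg_of_add_eq_zero_left h]
        exact hyv
      · simpa [h] using hyu
    rcases mul_eq_zero.1 hx0 with h | h
    · exact huv (by rw [h, eq_neg_of_add_eq_zero_left h, ← hneg]; simp [hsqa])
    · exact huv (by simp [h, hsqa])
  · obtain ⟨hu0, hv0⟩ := mul_ne_zero_iff.1 hx0
    refine huv ⟨fun hu => ?_, fun hv => ?_⟩
    · simpa [hu0] using hprod.div hu
    · simpa [hv0] using hprod.div hv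

lemma card_pow_add_pow_eq_le_four [Fintype F] (h4 : Fintype.card F % 4 = 1) (a b : F) :
    {x : F | (x + a) ^ ((Fintype.card F + 3) / 2) +
      x ^ ((Fintype.card F + 3) / 2) = b}.ncard ≤ 4 := by
  have h2 : (2 : F) ≠ 0 := Ring.two_ne_zero fun h => by
    have := FiniteField.even_card_of_char_two h
    omega
  obtain ⟨c₁, c₂, h⟩ := exists_subset_two_mul_add_sq_eq h4 a b
  calc _ ≤ _ := Set.ncard_le_ncard h (Set.toFinite _)
    _ ≤ _ := Set.ncard_union_le _ _
    _ ≤ 4 := add_le_add (ncard_two_mul_add_sq_eq_le_two h2 a c₁)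
      (ncard_two_mul_add_sq_eq_le_two h2 a c₂)

end PowerMap

theorem stmt_12 (p n : ℕ) [Fact p.Prime] (hp : 3 < p) (hodd : Odd p) (hn : 0 < n)
    (hmod : p ^ n % 4 = 1) :
    cDiffUniformity
        (fun x : GaloisField p n => x ^ ((p ^ n + 3) / 2)) (-1 : GaloisField p n) ≤ 4 := by
  let _ : Fintype (GaloisField p n) := Fintype.ofFinite _
  have hcard : Fintype.card (GaloisField p n) = p ^ n := by
    rw [← Nat.card_eq_fintype_card, GaloisField.card p n hn.ne']
  refine Finset.sup_le fun ab _ => ?_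
  have h := card_pow_add_pow_eq_le_four (hcard ▸ hmod) ab.1 ab.2
  rw [hcard] at h
  rw [← Nat.card_coe_set_eq] at h
  simp only [deltaCount, neg_one_mul, sub_neg_eq_add]
  exact h
end
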